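/- For every pattern σ ∈ S_k, every μ ∈ ℳ and every θ ∈ ℝ, the supremum sup_{ν∈ℳ}{θ t_σ(ν) − D(ν|μ)} is attained by at least one ν ∈ ℳ. Moreover, every maximizer ν satisfies ν ≪ μ, and its density g := dν/dμ satisfies the Euler–Lagrange equation: for μ-almost every z₁ ∈ [0,1]², g(z₁) = exp( kθ ∫_{([0,1]²)^{k−1}} h_σ(z₁,z₂,…,z_k) ∏_{a=2}^k g(z_a) dμ(z_a) ) divided by ∫_{[0,1]²} exp( kθ ∫_{([0,1]²)^{k−1}} h_σ(z₁',z₂,…,z_k) ∏_{a=2}^k g(z_a) dμ(z_a) ) dμ(z₁'). -/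

import Mathlib

open MeasureTheory Filter Topology
open scoped ENNReal

noncomputable section

/-- The plane `ℝ²`, carrier for measures on the unit square. -/
abbrev Ω2 : Type := ℝ × ℝ

/-- The unit square `[0,1]² ⊆ ℝ²`. -/
def unitSq : Set Ω2 := Set.Icc (0 : ℝ) 1 ×ˢ Set.Icc (0 : ℝ) 1

/-- Lebesgue measure on the unit square. -/
def lebSq : Measure Ω2 := volume.restrict unitSq

/-- `𝒫`: Borel probability measures concentrated on the unit square. -/
def Pcal : Set (ProbabilityMeasure Ω2) := {μ | (μ : Measure Ω2) unitSq = 1}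

/-- `ℳ`: members of `𝒫` whose two coordinate marginals are atomless
(equivalently, have continuous CDFs). -/
def Mcal : Set (ProbabilityMeasure Ω2) :=
  {μ | μ ∈ Pcal ∧ (∀ x : ℝ, (μ : Measure Ω2).map Prod.fst {x} = 0) ∧
      ∀ y : ℝ, (μ : Measure Ω2).map Prod.snd {y} = 0}

/-- The uniform distribution on `[0,1]`. -/
def unif01 : Measure ℝ := volume.restrict (Set.Icc (0 : ℝ) 1)

/-- `ℳ̃`: permutons, i.e. members of `𝒫` with both marginals uniform on `[0,1]`. -/
def Mtilde : Set (ProbabilityMeasure Ω2) :=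
  {μ | μ ∈ Pcal ∧ (μ : Measure Ω2).map Prod.fst = unif01 ∧
      (μ : Measure Ω2).map Prod.snd = unif01}

open scoped Classical in
/-- `h_σ`: indicator that the `k` points induce the pattern `σ`. -/
def hPat {k : ℕ} (σ : Equiv.Perm (Fin k)) (z : Fin k → Ω2) : ℝ :=
  if ∃ τ : Equiv.Perm (Fin k),
      StrictMono (fun i => (z (τ i)).1) ∧ StrictMono (fun i => (z (τ (σ⁻¹ i))).2)
  then 1 else 0

/-- Pattern density `t_σ(ν) = ∫ h_σ dν^{⊗k}`. -/
def tPat {k : ℕ} (σ : Equiv.Perm (Fin k)) (ν : Measure Ω2) : ℝ :=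
  ∫ z, hPat σ z ∂(Measure.pi fun _ : Fin k => ν)

open scoped Classical in
/-- The permutation induced by `n` labelled points of `ℝ²` (junk value `1` if the
coordinates are not in generic position). -/
def inducedPerm {n : ℕ} (z : Fin n → Ω2) : Equiv.Perm (Fin n) :=
  if h : ∃ σ : Equiv.Perm (Fin n), hPat σ z = 1 then h.choose else 1

/-- Empirical measure `Em(π) = (1/n) ∑ δ_{(i/n, π(i)/n)}` of a permutation, as a measure. -/
def EmM {n : ℕ} (π : Equiv.Perm (Fin n)) : Measure Ω2 :=
  (n : ℝ≥0∞)⁻¹ • ∑ i : Fin n, Measure.dirac ((((i : ℕ) + 1 : ℝ)) / n, (((π i : ℕ) + 1 : ℝ)) / n)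

open scoped Classical in
/-- Empirical measure of a permutation as a probability measure (junk value for `n = 0`). -/
def EmP {n : ℕ} (π : Equiv.Perm (Fin n)) : ProbabilityMeasure Ω2 :=
  if h : IsProbabilityMeasure (EmM π) then ⟨EmM π, h⟩
  else ⟨Measure.dirac 0, by infer_instance⟩

/-- `t_σ(π) := t_σ(Em(π))`. -/
def tPerm {k n : ℕ} (σ : Equiv.Perm (Fin k)) (π : Equiv.Perm (Fin n)) : ℝ := tPat σ (EmM π)

open scoped Classical in
/-- Kullback–Leibler divergence `D(ν|μ) ∈ [0,∞]`; for probability measures with `ν ≪ μ`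
it equals `∫ log(dν/dμ) dν`, written here through the nonnegative integrand
`g log g + 1 - g` of the density `g = dν/dμ` (the correction `∫ (1-g) dμ = 0`). -/
def KL (ν μ : Measure Ω2) : ℝ≥0∞ :=
  if ν ≪ μ then
    ∫⁻ z, ENNReal.ofReal ((ν.rnDeriv μ z).toReal * Real.log ((ν.rnDeriv μ z).toReal)
      + 1 - (ν.rnDeriv μ z).toReal) ∂μ
  else ∞

/-- CDF of the first marginal. -/
def cdfX (μ : Measure Ω2) (x : ℝ) : ℝ := (μ {p : Ω2 | p.1 ≤ x}).toReal

/-- CDF of the second marginal. -/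
def cdfY (μ : Measure Ω2) (y : ℝ) : ℝ := (μ {p : Ω2 | p.2 ≤ y}).toReal

/-- The map `𝒪`: pushforward of `μ` under `(x,y) ↦ (F₁(x), F₂(y))`. -/
def Omap (μ : Measure Ω2) : Measure Ω2 := μ.map fun p => (cdfX μ p.1, cdfY μ p.2)

/-- The product measure `μ^{⊗n}` governing `n` i.i.d. samples. -/
def pmeas (μ : Measure Ω2) (n : ℕ) : Measure (Fin n → Ω2) := Measure.pi fun _ => μ

/-- Log-partition function `F_n(σ,μ,θ) = log E[exp(nθ t_σ(π_{n,μ}))]`. -/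
def Fn {k : ℕ} (σ : Equiv.Perm (Fin k)) (μ : Measure Ω2) (θ : ℝ) (n : ℕ) : ℝ :=
  Real.log (∫ z, Real.exp (n * θ * tPerm σ (inducedPerm z)) ∂pmeas μ n)

/-- The Gibbs measure `Q_{n,σ,μ,θ}` on `([0,1]²)ⁿ`. -/
def Qgibbs {k : ℕ} (σ : Equiv.Perm (Fin k)) (μ : Measure Ω2) (θ : ℝ) (n : ℕ) :
    Measure (Fin n → Ω2) :=
  (pmeas μ n).withDensity fun z =>
    ENNReal.ofReal (Real.exp (n * θ * tPerm σ (inducedPerm z) - Fn σ μ θ n))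

/-- `F(σ,μ,θ) = sup_{ν ∈ ℳ} { θ t_σ(ν) − D(ν|μ) }`, valued in `EReal`. -/
def Fsup {k : ℕ} (σ : Equiv.Perm (Fin k)) (μ : Measure Ω2) (θ : ℝ) : EReal :=
  ⨆ ν ∈ Mcal, (((θ * tPat σ (ν : Measure Ω2) : ℝ) : EReal) - ((KL (↑ν) μ : ℝ≥0∞) : EReal))

/-- `ℱ(σ,μ,θ)`: the set of maximizers of `ν ↦ θ t_σ(ν) − D(ν|μ)` over `ℳ`. -/
def Fset {k : ℕ} (σ : Equiv.Perm (Fin k)) (μ : Measure Ω2) (θ : ℝ) :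
    Set (ProbabilityMeasure Ω2) :=
  {ν | ν ∈ Mcal ∧
    (((θ * tPat σ (ν : Measure Ω2) : ℝ) : EReal) - ((KL (↑ν) μ : ℝ≥0∞) : EReal)) = Fsup σ μ θ}

/-- `G(σ,μ,δ) = inf { D(ν|μ) : ν ∈ ℳ, t_σ(ν) ≥ δ }`. -/
def Gfun {k : ℕ} (σ : Equiv.Perm (Fin k)) (μ : Measure Ω2) (δ : ℝ) : ℝ≥0∞ :=
  ⨅ ν ∈ {ν : ProbabilityMeasure Ω2 | ν ∈ Mcal ∧ δ ≤ tPat σ (ν : Measure Ω2)}, KL (↑ν) μ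

/-- `𝒢(σ,μ,δ)`: the set of minimizers in the definition of `G(σ,μ,δ)`. -/
def Gset {k : ℕ} (σ : Equiv.Perm (Fin k)) (μ : Measure Ω2) (δ : ℝ) :
    Set (ProbabilityMeasure Ω2) :=
  {ν | (ν ∈ Mcal ∧ δ ≤ tPat σ (ν : Measure Ω2)) ∧ KL (↑ν) μ = Gfun σ μ δ}

/-- `α_σ(μ) = inf {δ : G(σ,μ,δ) = ∞}`. -/
def alphaSig {k : ℕ} (σ : Equiv.Perm (Fin k)) (μ : Measure Ω2) : ℝ :=
  sInf {δ : ℝ | Gfun σ μ δ = ∞}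

/-- `μ` is conditionally constant (CC) with respect to a pattern `σ` of size `k+1`:
the conditional probability `P(π_{X,Y} = σ | (X₁,Y₁))`, which for i.i.d. samples equals
`z ↦ ∫ h_σ(z, w) dμ^{⊗k}(w)`, is `μ`-a.s. equal to a constant `c ∈ [0,1]`. -/
def IsCC {k : ℕ} (σ : Equiv.Perm (Fin (k + 1))) (μ : Measure Ω2) : Prop :=
  ∃ c ∈ Set.Icc (0 : ℝ) 1, ∀ᵐ z ∂μ,
    (∫ w : Fin k → Ω2, hPat σ (Fin.cons z w) ∂pmeas μ k) = c

/-- The inversion pattern `21 ∈ S₂`. -/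
def inv2 : Equiv.Perm (Fin 2) := Equiv.swap 0 1

/-- Lévy–Prokhorov (extended) distance between measures on `ℝ²`. -/
def dLPE (μ ν : Measure Ω2) : ℝ≥0∞ := levyProkhorovEDist μ ν

/-- The topological support of a measure: the points whose every open neighbourhood
has positive measure. -/
def msupport (μ : Measure Ω2) : Set Ω2 :=
  {z | ∀ U : Set Ω2, IsOpen U → z ∈ U → 0 < μ U}


/-- The inner integral in the Euler–Lagrange equation:
`∫ h_σ(z₁, z₂, …, z_{k+1}) ∏_{a=2}^{k+1} g(z_a) dμ^{⊗k}`. -/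
def ELint {k : ℕ} (σ : Equiv.Perm (Fin (k + 1))) (μ : Measure Ω2) (g : Ω2 → ℝ) (z₁ : Ω2) : ℝ :=
  ∫ w : Fin k → Ω2, hPat σ (Fin.cons z₁ w) * ∏ a : Fin k, g (w a) ∂pmeas μ k


/-- The set of point configurations that induce the pattern `σ`. -/
def patSet {k : ℕ} (σ : Equiv.Perm (Fin k)) : Set (Fin k → Ω2) :=
  {z | ∃ τ : Equiv.Perm (Fin k),
    StrictMono (fun i => (z (τ i)).1) ∧ StrictMono (fun i => (z (τ (σ⁻¹ i))).2)}

lemma hPat_eq_indicator {k : ℕ} (σ : Equiv.Perm (Fin k)) :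
    hPat σ = (patSet σ).indicator fun _ => (1 : ℝ) := by
  classical
  ext z
  simp only [hPat, patSet, Set.indicator, Set.mem_ofPred_eq]
  congr

lemma hPat_nonneg {k : ℕ} (σ : Equiv.Perm (Fin k)) (z : Fin k → Ω2) : 0 ≤ hPat σ z := by
  unfold hPat; split_ifs <;> norm_num

lemma hPat_le_one {k : ℕ} (σ : Equiv.Perm (Fin k)) (z : Fin k → Ω2) : hPat σ z ≤ 1 := by
  unfold hPat; split_ifs <;> norm_num

lemma hPat_comp_perm {k : ℕ} (σ ρ : Equiv.Perm (Fin k)) (z : Fin k → Ω2) :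
    hPat σ (z ∘ ρ) = hPat σ z := by
  unfold hPat
  refine if_congr ⟨?_, ?_⟩ rfl rfl
  · rintro ⟨τ, h1, h2⟩
    exact ⟨ρ * τ, by simpa using! h1, by simpa using! h2⟩
  · rintro ⟨τ, h1, h2⟩
    exact ⟨ρ⁻¹ * τ, by simpa using h1, by simpa using h2⟩

lemma isOpen_setOf_strictMono_comp {X : Type*} [TopologicalSpace X] {k : ℕ}
    {f : X → Fin k → ℝ} (hf : ∀ i, Continuous fun x => f x i) :
    IsOpen {x | StrictMono (f x)} := by
  have : {x | StrictMono (f x)} = ⋂ i, ⋂ j, ⋂ (_ : i < j), {x | f x i < f x j} := by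
    ext x; simp [StrictMono]
  rw [this]
  exact isOpen_iInter_of_finite fun i => isOpen_iInter_of_finite fun j =>
    isOpen_iInter_of_finite fun _ => isOpen_lt (hf i) (hf j)

lemma isOpen_patSet {k : ℕ} (σ : Equiv.Perm (Fin k)) : IsOpen (patSet σ) := by
  have : patSet σ = ⋃ τ : Equiv.Perm (Fin k),
      ({z | StrictMono (fun i => (z (τ i)).1)} ∩
        {z | StrictMono (fun i => (z (τ (σ⁻¹ i))).2)}) := by
    ext z; simp [patSet]
  rw [this]
  exact isOpen_iUnion fun τ => (isOpen_setOf_strictMono_comp fun i => by fun_prop).inter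
    (isOpen_setOf_strictMono_comp fun i => by fun_prop)

lemma measurable_hPat {k : ℕ} (σ : Equiv.Perm (Fin k)) : Measurable (hPat σ) := by
  rw [hPat_eq_indicator]
  exact measurable_const.indicator (isOpen_patSet σ).measurableSet

lemma isClosed_setOf_monotone_comp {X : Type*} [TopologicalSpace X] {k : ℕ}
    {f : X → Fin k → ℝ} (hf : ∀ i, Continuous fun x => f x i) :
    IsClosed {x | Monotone (f x)} := by
  have : {x | Monotone (f x)} = ⋂ i, ⋂ j, ⋂ (_ : i ≤ j), {x | f x i ≤ f x j} := by
    ext x; simp [Monotone]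
  rw [this]
  exact isClosed_iInter fun i => isClosed_iInter fun j =>
    isClosed_iInter fun _ => isClosed_le (hf i) (hf j)

/-- A boundary configuration of the pattern event has a tie in one of the coordinates. -/
lemma frontier_patSet_subset {k : ℕ} (σ : Equiv.Perm (Fin k)) :
    frontier (patSet σ) ⊆ ⋃ i : Fin k, ⋃ j : Fin k, ⋃ (_ : i ≠ j),
      ({z | (z i).1 = (z j).1} ∪ {z | (z i).2 = (z j).2}) := by
  have hcl : closure (patSet σ) ⊆ ⋃ τ : Equiv.Perm (Fin k),
      ({z | Monotone (fun i => (z (τ i)).1)} ∩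
        {z | Monotone (fun i => (z (τ (σ⁻¹ i))).2)}) := by
    refine closure_minimal ?_ ?_
    · rintro z ⟨τ, h1, h2⟩
      exact Set.mem_iUnion.2 ⟨τ, h1.monotone, h2.monotone⟩
    · exact isClosed_iUnion_of_finite fun τ =>
        (isClosed_setOf_monotone_comp fun i => by fun_prop).inter
          (isClosed_setOf_monotone_comp fun i => by fun_prop)
  intro z hz
  rw [(isOpen_patSet σ).frontier_eq] at hz
  obtain ⟨τ, h1, h2⟩ := Set.mem_iUnion.1 (hcl hz.1)
  by_contra hcon
  simp only [Set.mem_iUnion, Set.mem_union, Set.mem_ofPred_eq, not_exists, not_or] at hcon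
  refine hz.2 ⟨τ, h1.strictMono_of_injective ?_, h2.strictMono_of_injective ?_⟩
  · intro i j hij
    by_contra hne
    exact (hcon (τ i) (τ j) (fun h => hne (τ.injective h))).1 hij
  · intro i j hij
    by_contra hne
    exact (hcon (τ (σ⁻¹ i)) (τ (σ⁻¹ j)) (fun h => hne (σ⁻¹.injective (τ.injective h)))).2 hij

lemma measure_pi_tie_eq_zero {k : ℕ} (ν : Measure Ω2) [IsProbabilityMeasure ν] {f : Ω2 → ℝ}
    (hf : Measurable f) (hν : ∀ x, ν.map f {x} = 0) {i j : Fin k} (hij : i ≠ j) :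
    (Measure.pi fun _ : Fin k => ν) {z | f (z i) = f (z j)} = 0 := by
  have hind : ProbabilityTheory.IndepFun (fun z : Fin k → Ω2 => f (z i))
      (fun z : Fin k → Ω2 => f (z j)) (Measure.pi fun _ : Fin k => ν) :=
    (ProbabilityTheory.iIndepFun_pi (X := fun _ => f) (μ := fun _ : Fin k => ν)
      fun _ => hf.aemeasurable).indepFun hij
  have hmap : ∀ a : Fin k, (Measure.pi fun _ : Fin k => ν).map (fun z => f (z a)) = ν.map f := by
    intro a
    have h := (measurePreserving_eval (fun _ : Fin k => ν) a).map_eq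
    conv_rhs => rw [← h, Measure.map_map hf (measurable_pi_apply a)]
    rfl
  have hmi : Measurable fun z : Fin k → Ω2 => f (z i) := hf.comp (measurable_pi_apply i)
  have hmj : Measurable fun z : Fin k → Ω2 => f (z j) := hf.comp (measurable_pi_apply j)
  have hp := (ProbabilityTheory.indepFun_iff_map_prod_eq_prod_map_map hmi.aemeasurable
    hmj.aemeasurable).1 hind
  rw [hmap, hmap] at hp
  have : IsProbabilityMeasure (ν.map f) := Measure.isProbabilityMeasure_map hf.aemeasurable
  have hD : MeasurableSet {p : ℝ × ℝ | p.1 = p.2} :=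
    measurableSet_eq_fun measurable_fst measurable_snd
  have : (Measure.pi fun _ : Fin k => ν) {z | f (z i) = f (z j)}
      = ((Measure.pi fun _ : Fin k => ν).map fun z => (f (z i), f (z j)))
          {p : ℝ × ℝ | p.1 = p.2} := by
    rw [Measure.map_apply (hmi.prodMk hmj) hD]; rfl
  rw [this, hp, Measure.prod_apply hD]
  simp only [lintegral_eq_zero_iff (measurable_measure_prodMk_left hD)]
  refine Filter.Eventually.of_forall fun x => ?_
  have hx : Prod.mk x ⁻¹' {p : ℝ × ℝ | p.1 = p.2} = {x} := by
    ext y; simp [eq_comm]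
  simp [hx, hν x]

lemma measure_pi_frontier_patSet {k : ℕ} (σ : Equiv.Perm (Fin k)) {ν : ProbabilityMeasure Ω2}
    (hν : ν ∈ Mcal) :
    (Measure.pi fun _ : Fin k => (ν : Measure Ω2)) (frontier (patSet σ)) = 0 := by
  refine measure_mono_null (frontier_patSet_subset σ) ?_
  simp only [measure_iUnion_null_iff]
  intro i j hij
  exact measure_union_null (measure_pi_tie_eq_zero _ measurable_fst hν.2.1 hij)
    (measure_pi_tie_eq_zero _ measurable_snd hν.2.2 hij)

lemma tPat_eq_measureReal {k : ℕ} (σ : Equiv.Perm (Fin k)) (ν : Measure Ω2) :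
    tPat σ ν = (Measure.pi fun _ : Fin k => ν).real (patSet σ) := by
  rw [tPat, hPat_eq_indicator, integral_indicator_const _ (isOpen_patSet σ).measurableSet]
  simp

lemma abs_tPat_le_one {k : ℕ} (σ : Equiv.Perm (Fin k)) (ν : Measure Ω2)
    [IsProbabilityMeasure ν] : |tPat σ ν| ≤ 1 := by
  rw [tPat_eq_measureReal, abs_of_nonneg measureReal_nonneg]
  exact measureReal_le_one

/-- Pattern densities are weakly continuous at measures with atomless marginals. -/
lemma tendsto_tPat {k : ℕ} (σ : Equiv.Perm (Fin k)) {ι : Type*} {L : Filter ι}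
    {νs : ι → ProbabilityMeasure Ω2} {ν : ProbabilityMeasure Ω2} (hν : ν ∈ Mcal)
    (hlim : Tendsto νs L (𝓝 ν)) :
    Tendsto (fun i => tPat σ (νs i : Measure Ω2)) L (𝓝 (tPat σ (ν : Measure Ω2))) := by
  simp only [tPat_eq_measureReal]
  have hpi : Tendsto (fun i => ProbabilityMeasure.pi fun _ : Fin k => νs i) L
      (𝓝 (ProbabilityMeasure.pi fun _ : Fin k => ν)) :=
    (ProbabilityMeasure.continuous_pi.tendsto _).comp (tendsto_pi_nhds.2 fun _ => hlim)
  have h := ProbabilityMeasure.tendsto_measure_of_null_frontier_of_tendsto' hpi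
    (E := patSet σ) (measure_pi_frontier_patSet σ hν)
  exact (ENNReal.tendsto_toReal (measure_ne_top _ _)).comp h

lemma isCompact_Pcal : IsCompact Pcal := by
  have hK : IsCompact unitSq := isCompact_Icc.prod isCompact_Icc
  have h := isCompact_setOfPred_probabilityMeasure_mass_eq_compl_isCompact_le (E := Ω2)
    (u := fun _ => 0) (K := fun _ => unitSq) tendsto_const_nhds (fun _ => hK) (Or.inr monotone_const)
  convert h using 1
  ext μ
  simp only [Pcal, Set.mem_ofPred_eq, forall_const, nonpos_iff_eq_zero]
  rw [ProbabilityMeasure.null_iff_toMeasure_null, prob_compl_eq_zero_iff hK.measurableSet]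

lemma mem_Mcal_of_absolutelyContinuous {μ ν : ProbabilityMeasure Ω2} (hμ : μ ∈ Mcal)
    (h : (ν : Measure Ω2) ≪ (μ : Measure Ω2)) : ν ∈ Mcal := by
  have hU : MeasurableSet unitSq := measurableSet_Icc.prod measurableSet_Icc
  refine ⟨?_, fun x => h.map measurable_fst (hμ.2.1 x), fun x => h.map measurable_snd (hμ.2.2 x)⟩
  have h1 : (μ : Measure Ω2) unitSq = 1 := hμ.1
  exact (prob_compl_eq_zero_iff hU).1 (h ((prob_compl_eq_zero_iff hU).2 h1))

lemma KL_eq_lintegral_klFun {ν μ : Measure Ω2} (h : ν ≪ μ) :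
    KL ν μ = ∫⁻ z, ENNReal.ofReal (InformationTheory.klFun (ν.rnDeriv μ z).toReal) ∂μ := by
  unfold KL
  rw [if_pos h]
  rfl

lemma absolutelyContinuous_of_KL_ne_top {ν μ : Measure Ω2} (h : KL ν μ ≠ ∞) : ν ≪ μ := by
  by_contra hn
  exact h (by unfold KL; rw [if_neg hn])

lemma KL_self (μ : Measure Ω2) [SigmaFinite μ] : KL μ μ = 0 := by
  rw [KL_eq_lintegral_klFun Measure.AbsolutelyContinuous.rfl]
  rw [lintegral_congr_ae (g := fun _ => 0), lintegral_zero]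
  filter_upwards [Measure.rnDeriv_self μ] with z hz
  simp [hz, InformationTheory.klFun_one]

/-- The convex conjugate inequality (Young's inequality) for `klFun`. -/
lemma mul_sub_exp_le_klFun {g : ℝ} (hg : 0 ≤ g) (t : ℝ) :
    t * g - (Real.exp t - 1) ≤ InformationTheory.klFun g := by
  rw [InformationTheory.klFun_apply]
  rcases hg.eq_or_lt with rfl | hg
  · have := Real.exp_pos t
    simp; linarith
  · have h := Real.add_one_le_exp (t - Real.log g)
    rw [Real.exp_sub, Real.exp_log hg, le_div_iff₀ hg] at h
    nlinarith

lemma integrable_klFun_of_KL_ne_top {ν μ : Measure Ω2} (h : KL ν μ ≠ ∞) :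
    Integrable (fun z => InformationTheory.klFun (ν.rnDeriv μ z).toReal) μ := by
  have hac := absolutelyContinuous_of_KL_ne_top h
  rw [KL_eq_lintegral_klFun hac] at h
  have hm : Measurable fun z => InformationTheory.klFun (ν.rnDeriv μ z).toReal :=
    InformationTheory.measurable_klFun.comp (Measure.measurable_rnDeriv ν μ).ennreal_toReal
  refine (lintegral_ofReal_ne_top_iff_integrable hm.aestronglyMeasurable ?_).1 h
  exact Eventually.of_forall fun z => InformationTheory.klFun_nonneg ENNReal.toReal_nonneg

lemma KL_eq_ofReal_integral {ν μ : Measure Ω2} (h : KL ν μ ≠ ∞) :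
    KL ν μ = ENNReal.ofReal (∫ z, InformationTheory.klFun (ν.rnDeriv μ z).toReal ∂μ) := by
  rw [KL_eq_lintegral_klFun (absolutelyContinuous_of_KL_ne_top h),
    ofReal_integral_eq_lintegral_ofReal (integrable_klFun_of_KL_ne_top h)]
  exact Eventually.of_forall fun z => InformationTheory.klFun_nonneg ENNReal.toReal_nonneg

/-- The easy half of the variational formula for the divergence. -/
lemma integral_sub_integral_exp_le_of_KL_le {ν μ : Measure Ω2} [IsProbabilityMeasure ν]
    [IsProbabilityMeasure μ] {c : ℝ} (hc : 0 ≤ c) (h : KL ν μ ≤ ENNReal.ofReal c)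
    (φ : BoundedContinuousFunction Ω2 ℝ) :
    ∫ z, φ z ∂ν - ∫ z, (Real.exp (φ z) - 1) ∂μ ≤ c := by
  have hne : KL ν μ ≠ ∞ := ne_top_of_le_ne_top ENNReal.ofReal_ne_top h
  have hac := absolutelyContinuous_of_KL_ne_top hne
  have hint := integrable_klFun_of_KL_ne_top hne
  rw [KL_eq_ofReal_integral hne, ENNReal.ofReal_le_ofReal_iff hc] at h
  refine le_trans ?_ h
  rw [← integral_rnDeriv_smul hac]
  have hg : Integrable (fun z => (ν.rnDeriv μ z).toReal) μ := Measure.integrable_toReal_rnDeriv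
  have h1 : Integrable (fun z => (ν.rnDeriv μ z).toReal • φ z) μ := by
    simp only [smul_eq_mul]
    exact hg.mul_bdd (c := ‖φ‖) φ.continuous.aestronglyMeasurable
      (Eventually.of_forall fun z => φ.norm_coe_le_norm z)
  have h2 : Integrable (fun z => Real.exp (φ z) - 1) μ := by
    refine Integrable.sub ?_ (integrable_const _)
    refine Integrable.of_bound (C := Real.exp ‖φ‖)
      (Real.continuous_exp.comp φ.continuous).aestronglyMeasurable (Eventually.of_forall fun z => ?_)
    rw [Real.norm_eq_abs, Real.abs_exp, Real.exp_le_exp]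
    exact (le_abs_self _).trans (φ.norm_coe_le_norm z)
  rw [← integral_sub h1 h2]
  refine integral_mono (h1.sub h2) hint fun z => ?_
  have := mul_sub_exp_le_klFun (ENNReal.toReal_nonneg (a := ν.rnDeriv μ z)) (φ z)
  simp only [smul_eq_mul]
  linarith

lemma exp_sub_exp_le {M a b : ℝ} (ha : a ≤ M) :
    Real.exp a - Real.exp b ≤ Real.exp M * |a - b| := by
  have h1 : Real.exp a - Real.exp b ≤ Real.exp a * (a - b) := by
    have h := Real.add_one_le_exp (b - a)
    have he : Real.exp b = Real.exp a * Real.exp (b - a) := by rw [← Real.exp_add]; congr 1; ring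
    have := Real.exp_pos a
    rw [he]; nlinarith
  have h2 : Real.exp a * (a - b) ≤ Real.exp a * |a - b| :=
    mul_le_mul_of_nonneg_left (le_abs_self _) (Real.exp_pos a).le
  have h3 : Real.exp a * |a - b| ≤ Real.exp M * |a - b| :=
    mul_le_mul_of_nonneg_right (Real.exp_le_exp.2 ha) (abs_nonneg _)
  linarith

/-- A dual bound on bounded continuous functions extends to bounded measurable functions. -/
lemma integral_sub_integral_exp_le_of_measurable {ν μ : Measure Ω2} [IsProbabilityMeasure ν]
    [IsProbabilityMeasure μ] {c : ℝ}
    (h : ∀ φ : BoundedContinuousFunction Ω2 ℝ,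
      ∫ z, φ z ∂ν - ∫ z, (Real.exp (φ z) - 1) ∂μ ≤ c)
    {f : Ω2 → ℝ} (hf : Measurable f) {M : ℝ} (hM : ∀ z, |f z| ≤ M) :
    ∫ z, f z ∂ν - ∫ z, (Real.exp (f z) - 1) ∂μ ≤ c := by
  have hM0 : 0 ≤ M := (abs_nonneg _).trans (hM 0)
  have key : ∀ ε : ℝ, 0 < ε →
      ∫ z, f z ∂ν - ∫ z, (Real.exp (f z) - 1) ∂μ ≤ c + (1 + Real.exp M) * ε := by
    intro ε hε
    have hfi : Integrable f (μ + ν) :=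
      Integrable.of_bound hf.aestronglyMeasurable M (Eventually.of_forall hM)
    obtain ⟨g, hg, hgi⟩ := hfi.exists_boundedContinuous_integral_sub_le hε
    let φ : BoundedContinuousFunction Ω2 ℝ := BoundedContinuousFunction.ofNormedAddCommGroup
      (fun z => max (-M) (min (g z) M)) (by fun_prop) M (fun z => by
        rw [Real.norm_eq_abs, abs_le]
        exact ⟨le_max_left _ _, max_le (by linarith) (min_le_right _ _)⟩)
    have hφ : ∀ z, φ z = max (-M) (min (g z) M) := fun z => rfl
    have hφM : ∀ z, φ z ≤ M := fun z => max_le (by linarith) (min_le_right _ _)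
    have hφabs : ∀ z, ‖φ z‖ ≤ M := fun z => by
      rw [Real.norm_eq_abs, abs_le]
      exact ⟨le_max_left _ _, hφM z⟩
    have hfφ : ∀ z, |f z - φ z| ≤ |f z - g z| := fun z => by
      have h1 : f z = max (-M) (min (f z) M) := by
        rw [min_eq_left (abs_le.1 (hM z)).2, max_eq_right (abs_le.1 (hM z)).1]
      rw [hφ]
      conv_lhs => rw [h1]
      exact (abs_max_sub_max_le_max _ _ _ _).trans (max_le (by simp)
        ((abs_min_sub_min_le_max _ _ _ _).trans (max_le le_rfl (by simp))))
    have hdiff : Integrable (fun z => |f z - g z|) (μ + ν) := (hfi.sub hgi).abs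
    have hsum : ∫ z, |f z - g z| ∂μ + ∫ z, |f z - g z| ∂ν ≤ ε := by
      rw [← integral_add_measure hdiff.left_of_add_measure hdiff.right_of_add_measure]
      exact hg
    have hμ0 : 0 ≤ ∫ z, |f z - g z| ∂μ := integral_nonneg fun _ => abs_nonneg _
    have hν0 : 0 ≤ ∫ z, |f z - g z| ∂ν := integral_nonneg fun _ => abs_nonneg _
    have hφν : Integrable φ ν := Integrable.of_bound φ.continuous.aestronglyMeasurable M
      (Eventually.of_forall hφabs)
    have hexp : ∀ u : Ω2 → ℝ, Measurable u → (∀ z, u z ≤ M) →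
        Integrable (fun z => Real.exp (u z) - 1) μ := fun u hu huM => by
      refine Integrable.sub ?_ (integrable_const _)
      refine Integrable.of_bound (C := Real.exp M)
        (Real.measurable_exp.comp hu).aestronglyMeasurable (Eventually.of_forall fun z => ?_)
      rw [Real.norm_eq_abs, Real.abs_exp, Real.exp_le_exp]
      exact huM z
    have hfM : ∀ z, f z ≤ M := fun z => (le_abs_self _).trans (hM z)
    have e1 : ∫ z, f z ∂ν - ∫ z, φ z ∂ν ≤ ∫ z, |f z - g z| ∂ν := by
      rw [← integral_sub hfi.right_of_add_measure hφν]
      exact integral_mono (hfi.right_of_add_measure.sub hφν) hdiff.right_of_add_measure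
        fun z => (le_abs_self _).trans (hfφ z)
    have hφe := hexp φ φ.continuous.measurable hφM
    have hfe := hexp f hf hfM
    have e2 : ∫ z, (Real.exp (φ z) - 1) ∂μ - ∫ z, (Real.exp (f z) - 1) ∂μ
        ≤ Real.exp M * ∫ z, |f z - g z| ∂μ := by
      rw [← integral_sub hφe hfe, ← integral_const_mul]
      refine integral_mono (hφe.sub hfe) (hdiff.left_of_add_measure.const_mul _) fun z => ?_
      have h1 := exp_sub_exp_le (b := f z) (hφM z)
      have h2 : |φ z - f z| ≤ |f z - g z| := by rw [abs_sub_comm]; exact hfφ z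
      have h3 := mul_le_mul_of_nonneg_left h2 (Real.exp_pos M).le
      simp only
      linarith
    have e3 := h φ
    have e4 : Real.exp M * ∫ z, |f z - g z| ∂μ ≤ Real.exp M * ε :=
      mul_le_mul_of_nonneg_left (by linarith) (Real.exp_pos M).le
    linarith
  refine le_of_forall_pos_le_add fun δ hδ => ?_
  have hpos : 0 < 1 + Real.exp M := by positivity
  have := key (δ / (1 + Real.exp M)) (by positivity)
  rwa [mul_div_cancel₀ _ hpos.ne'] at this

lemma absolutelyContinuous_of_integral_sub_le {ν μ : Measure Ω2} [IsProbabilityMeasure ν]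
    [IsProbabilityMeasure μ] {c : ℝ}
    (h : ∀ φ : BoundedContinuousFunction Ω2 ℝ,
      ∫ z, φ z ∂ν - ∫ z, (Real.exp (φ z) - 1) ∂μ ≤ c) : ν ≪ μ := by
  refine Measure.AbsolutelyContinuous.mk fun A hA hμA => ?_
  have key : ∀ M : ℝ, 0 ≤ M → M * ν.real A ≤ c := by
    intro M hM
    have h1 := integral_sub_integral_exp_le_of_measurable h
      (f := A.indicator fun _ => M) (measurable_const.indicator hA) (M := M) (fun z => by
        by_cases hz : z ∈ A <;> simp [hz, abs_of_nonneg hM, hM])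
    have h2 : ∫ z, (Real.exp (A.indicator (fun _ => M) z) - 1) ∂μ = 0 := by
      rw [integral_congr_ae (g := fun _ => 0), integral_zero]
      filter_upwards [compl_mem_ae_iff.2 hμA] with z hz
      have hz : z ∉ A := hz
      simp [hz]
    rw [h2, integral_indicator_const _ hA, smul_eq_mul] at h1
    linarith
  by_contra hne
  have hpos : 0 < ν.real A := ENNReal.toReal_pos hne (measure_ne_top _ _)
  have hc : 0 ≤ c := by simpa using key 0 le_rfl
  have := key ((c + 1) / ν.real A) (by positivity)
  rw [div_mul_cancel₀ _ hpos.ne'] at this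
  linarith

lemma tendsto_mul_log_clamp {g : ℝ} (hg : 0 ≤ g) :
    Tendsto (fun n : ℕ => g * Real.log (max ((n : ℝ) + 1)⁻¹ (min g (n + 1)))
      - (max ((n : ℝ) + 1)⁻¹ (min g (n + 1)) - 1)) atTop (𝓝 (InformationTheory.klFun g)) := by
  have hinv : Tendsto (fun n : ℕ => ((n : ℝ) + 1)⁻¹) atTop (𝓝 0) := by
    simpa [one_div] using tendsto_one_div_add_atTop_nhds_zero_nat (𝕜 := ℝ)
  rcases hg.eq_or_lt with rfl | hg
  · have : ∀ n : ℕ, max ((n : ℝ) + 1)⁻¹ (min 0 (n + 1)) = ((n : ℝ) + 1)⁻¹ := fun n => by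
      rw [min_eq_left (by positivity), max_eq_left (by positivity)]
    simp only [this]
    simpa [InformationTheory.klFun_zero] using hinv.const_sub 1
  · refine Tendsto.congr' ?_ tendsto_const_nhds
    filter_upwards [hinv.eventually (gt_mem_nhds hg),
      (tendsto_natCast_atTop_atTop (R := ℝ)).eventually_ge_atTop g] with n h1 h2
    rw [min_eq_left (by linarith), max_eq_right h1.le, InformationTheory.klFun_apply]
    ring

lemma mul_log_clamp_nonneg {g a b : ℝ} (ha : 0 < a) (ha1 : a ≤ 1) (hb : 1 ≤ b) :
    0 ≤ g * Real.log (max a (min g b)) - (max a (min g b) - 1) := by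
  set c := max a (min g b) with hc
  have hcpos : 0 < c := lt_max_of_lt_left ha
  have h1 := Real.one_sub_inv_le_log_of_pos hcpos
  have h2 := Real.log_le_sub_one_of_pos hcpos
  have h3 : c * (1 - c⁻¹) = c - 1 := by field_simp
  rcases le_total c 1 with hc1 | hc1
  · have hgc : g ≤ c ∨ c = 1 := by
      rcases le_total g b with h | h
      · left; rw [hc, min_eq_left h]; exact le_max_right _ _
      · have hbc : b ≤ c := by rw [hc, min_eq_right h]; exact le_max_right _ _
        exact Or.inr (le_antisymm hc1 (hb.trans hbc))
    rcases hgc with hgc | hgc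
    · have h4 : Real.log c ≤ 0 := by linarith
      nlinarith
    · rw [hgc]; simp
  · have hgc : c ≤ g ∨ c = 1 := by
      rcases le_total a (min g b) with h | h
      · left; rw [hc, max_eq_right h]; exact min_le_left _ _
      · right; rw [hc, max_eq_left h] at hc1 ⊢; linarith
    rcases hgc with hgc | hgc
    · have h4 : 0 ≤ Real.log c := Real.log_nonneg hc1
      nlinarith
    · rw [hgc]; simp

/-- The dual bound characterises the divergence: it implies absolute continuity and `D ≤ c`. -/
lemma KL_le_of_integral_sub_le {ν μ : Measure Ω2} [IsProbabilityMeasure ν]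
    [IsProbabilityMeasure μ] {c : ℝ}
    (h : ∀ φ : BoundedContinuousFunction Ω2 ℝ,
      ∫ z, φ z ∂ν - ∫ z, (Real.exp (φ z) - 1) ∂μ ≤ c) : KL ν μ ≤ ENNReal.ofReal c := by
  have hac := absolutelyContinuous_of_integral_sub_le h
  rw [KL_eq_lintegral_klFun hac]
  set g : Ω2 → ℝ := fun z => (ν.rnDeriv μ z).toReal with hgdef
  have hgm : Measurable g := (Measure.measurable_rnDeriv ν μ).ennreal_toReal
  have hg0 : ∀ z, 0 ≤ g z := fun z => ENNReal.toReal_nonneg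
  have hgi : Integrable g μ := Measure.integrable_toReal_rnDeriv
  let C : ℕ → Ω2 → ℝ := fun n z => max ((n : ℝ) + 1)⁻¹ (min (g z) (n + 1))
  have hCm : ∀ n, Measurable (C n) := fun n => by fun_prop
  have hn1 : ∀ n : ℕ, (1 : ℝ) ≤ n + 1 := fun n => by simp
  have hinv : ∀ n : ℕ, ((n : ℝ) + 1)⁻¹ ≤ 1 := fun n => inv_le_one_of_one_le₀ (hn1 n)
  have hClow : ∀ (n : ℕ) z, ((n : ℝ) + 1)⁻¹ ≤ C n z := fun n z => le_max_left _ _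
  have hCup : ∀ (n : ℕ) z, C n z ≤ n + 1 := fun n z =>
    max_le ((hinv n).trans (hn1 n)) (min_le_right _ _)
  have hCpos : ∀ (n : ℕ) z, 0 < C n z := fun n z => lt_of_lt_of_le (by positivity) (hClow n z)
  have hlogM : ∀ (n : ℕ) z, |Real.log (C n z)| ≤ Real.log (n + 1) := fun n z => by
    rw [abs_le, ← Real.log_inv]
    exact ⟨Real.log_le_log (by positivity) (hClow n z), Real.log_le_log (hCpos n z) (hCup n z)⟩
  have hbound : ∀ n, ∫⁻ z, ENNReal.ofReal (g z * Real.log (C n z) - (C n z - 1)) ∂μ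
      ≤ ENNReal.ofReal c := by
    intro n
    have hlm : Measurable fun z => Real.log (C n z) := Real.measurable_log.comp (hCm n)
    have h1 := integral_sub_integral_exp_le_of_measurable h hlm (hlogM n)
    simp only [Real.exp_log (hCpos n _)] at h1
    rw [← integral_rnDeriv_smul hac] at h1
    have hi1 : Integrable (fun z => g z * Real.log (C n z)) μ :=
      hgi.mul_bdd (c := Real.log (n + 1)) hlm.aestronglyMeasurable
        (Eventually.of_forall (hlogM n))
    have hi2 : Integrable (fun z => C n z - 1) μ := by
      refine Integrable.sub (Integrable.of_bound (hCm n).aestronglyMeasurable (n + 1)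
        (Eventually.of_forall fun z => ?_)) (integrable_const _)
      rw [Real.norm_eq_abs, abs_of_pos (hCpos n z)]
      exact hCup n z
    have hi3 : Integrable (fun z => g z * Real.log (C n z) - (C n z - 1)) μ := hi1.sub hi2
    rw [← ofReal_integral_eq_lintegral_ofReal hi3 (Eventually.of_forall fun z =>
      mul_log_clamp_nonneg (by positivity) (hinv n) (hn1 n))]
    refine ENNReal.ofReal_le_ofReal ?_
    rw [integral_sub hi1 hi2]
    exact h1
  have hlim : ∀ z, Tendsto (fun n => ENNReal.ofReal (g z * Real.log (C n z) - (C n z - 1))) atTop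
      (𝓝 (ENNReal.ofReal (InformationTheory.klFun (g z)))) := fun z =>
    (ENNReal.continuous_ofReal.tendsto _).comp (tendsto_mul_log_clamp (hg0 z))
  calc ∫⁻ z, ENNReal.ofReal (InformationTheory.klFun (g z)) ∂μ
      = ∫⁻ z, liminf (fun n => ENNReal.ofReal (g z * Real.log (C n z) - (C n z - 1))) atTop ∂μ :=
        lintegral_congr fun z => (hlim z).liminf_eq.symm
    _ ≤ liminf (fun n => ∫⁻ z, ENNReal.ofReal (g z * Real.log (C n z) - (C n z - 1)) ∂μ) atTop :=
        lintegral_liminf_le fun n => by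
          have := hCm n
          fun_prop
    _ ≤ ENNReal.ofReal c := by
        refine liminf_le_of_le (by isBoundedDefault) fun b hb => ?_
        obtain ⟨n, hn⟩ := hb.exists
        exact hn.trans (hbound n)

/-- Weak lower semicontinuity of the divergence, with varying upper bounds. -/
lemma KL_le_of_tendsto {ι : Type*} {L : Filter ι} [L.NeBot] {νs : ι → ProbabilityMeasure Ω2}
    {ν : ProbabilityMeasure Ω2} {μ : Measure Ω2} [IsProbabilityMeasure μ] {cs : ι → ℝ} {c : ℝ}
    (hlim : Tendsto νs L (𝓝 ν)) (hc : Tendsto cs L (𝓝 c)) (hcs : ∀ i, 0 ≤ cs i)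
    (h : ∀ i, KL (νs i) μ ≤ ENNReal.ofReal (cs i)) : KL ν μ ≤ ENNReal.ofReal c := by
  refine KL_le_of_integral_sub_le fun φ => ?_
  have h1 := (ProbabilityMeasure.tendsto_iff_forall_integral_tendsto.1 hlim φ).sub_const
    (∫ z, (Real.exp (φ z) - 1) ∂μ)
  exact le_of_tendsto_of_tendsto' h1 hc fun i =>
    integral_sub_integral_exp_le_of_KL_le (hcs i) (h i) φ

lemma theta_mul_tPat_le_abs {k : ℕ} (σ : Equiv.Perm (Fin k)) (θ : ℝ) (ν : Measure Ω2)
    [IsProbabilityMeasure ν] : θ * tPat σ ν ≤ |θ| := by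
  refine (le_abs_self _).trans ?_
  rw [abs_mul]
  exact mul_le_of_le_one_right (abs_nonneg _) (abs_tPat_le_one σ ν)

lemma theta_mul_tPat_le_Fsup {k : ℕ} (σ : Equiv.Perm (Fin k)) {μ : ProbabilityMeasure Ω2} (hμ : μ ∈ Mcal)
    (θ : ℝ) : ((θ * tPat σ (μ : Measure Ω2) : ℝ) : EReal) ≤ Fsup σ (μ : Measure Ω2) θ := by
  have h := le_iSup₂ (f := fun (ν : ProbabilityMeasure Ω2) (_ : ν ∈ Mcal) =>
    (((θ * tPat σ (ν : Measure Ω2) : ℝ) : EReal) - ((KL (↑ν) (μ : Measure Ω2) : ℝ≥0∞) : EReal)))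
    μ hμ
  simpa [Fsup, KL_self] using h

lemma Fsup_le_abs {k : ℕ} (σ : Equiv.Perm (Fin k)) (μ : Measure Ω2) (θ : ℝ) :
    Fsup σ μ θ ≤ ((|θ| : ℝ) : EReal) := by
  refine iSup₂_le fun ν _ => ?_
  refine (EReal.sub_le_sub (EReal.coe_le_coe_iff.2 (theta_mul_tPat_le_abs σ θ (ν : Measure Ω2)))
    (EReal.coe_ennreal_nonneg _)).trans ?_
  simp

lemma KL_ne_top_of_lt_sub {a b : ℝ} {D : ℝ≥0∞} (h : (b : EReal) < (a : EReal) - (D : EReal)) :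
    D ≠ ∞ := by
  rintro rfl
  simp at h

lemma coe_sub_coe_ofReal {a d : ℝ} (hd : 0 ≤ d) :
    (a : EReal) - ((ENNReal.ofReal d : ℝ≥0∞) : EReal) = ((a - d : ℝ) : EReal) := by
  rw [EReal.coe_ennreal_ofReal, max_eq_left hd, EReal.coe_sub]

/-- The supremum defining `F(σ, μ, θ)` is attained. -/
lemma Fset_nonempty {k : ℕ} (σ : Equiv.Perm (Fin k)) {μ : ProbabilityMeasure Ω2} (hμ : μ ∈ Mcal)
    (θ : ℝ) : (Fset σ (μ : Measure Ω2) θ).Nonempty := by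
  obtain ⟨S, hS⟩ : ∃ S : ℝ, (S : EReal) = Fsup σ (μ : Measure Ω2) θ := by
    refine ⟨_, EReal.coe_toReal (ne_top_of_le_ne_top (EReal.coe_ne_top _)
      (Fsup_le_abs σ (μ : Measure Ω2) θ)) (ne_bot_of_le_ne_bot (EReal.coe_ne_bot _)
      (theta_mul_tPat_le_Fsup σ hμ θ))⟩
  have hex : ∀ n : ℕ, ∃ ν : ProbabilityMeasure Ω2, ν ∈ Mcal ∧
      ((S - 1 / ((n : ℝ) + 1) : ℝ) : EReal) <
        (((θ * tPat σ (ν : Measure Ω2) : ℝ) : EReal)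
          - ((KL (↑ν) (μ : Measure Ω2) : ℝ≥0∞) : EReal)) := by
    intro n
    have hlt : ((S - 1 / ((n : ℝ) + 1) : ℝ) : EReal) < Fsup σ (μ : Measure Ω2) θ := by
      rw [← hS, EReal.coe_lt_coe_iff]
      have : 0 < 1 / ((n : ℝ) + 1) := by positivity
      linarith
    obtain ⟨ν, hν⟩ := lt_iSup_iff.1 hlt
    obtain ⟨hνM, hν⟩ := lt_iSup_iff.1 hν
    exact ⟨ν, hνM, hν⟩
  choose νs hνM hνs using hex
  let d : ℕ → ℝ := fun n => (KL (νs n) (μ : Measure Ω2)).toReal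
  have hKL : ∀ n, KL (νs n) (μ : Measure Ω2) = ENNReal.ofReal (d n) := fun n =>
    (ENNReal.ofReal_toReal (KL_ne_top_of_lt_sub (hνs n))).symm
  have hd0 : ∀ n, 0 ≤ d n := fun n => ENNReal.toReal_nonneg
  have hd : ∀ n : ℕ, d n ≤ θ * tPat σ (νs n : Measure Ω2) - S + 1 / ((n : ℝ) + 1) := by
    intro n
    have h := hνs n
    rw [hKL, coe_sub_coe_ofReal (hd0 n), EReal.coe_lt_coe_iff] at h
    linarith
  obtain ⟨ν, -, hν⟩ := isCompact_Pcal.ultrafilter_le_nhds ((hyperfilter ℕ).map νs) (by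
    rw [Ultrafilter.coe_map, le_principal_iff]
    exact Filter.mem_map.2 (Eventually.of_forall fun n => (hνM n).1))
  have hlim : Tendsto νs (hyperfilter ℕ : Filter ℕ) (𝓝 ν) := hν
  have hone : Tendsto (fun n : ℕ => 1 / ((n : ℝ) + 1)) (hyperfilter ℕ : Filter ℕ) (𝓝 0) :=
    tendsto_one_div_add_atTop_nhds_zero_nat.mono_left Nat.hyperfilter_le_atTop
  have hac : (ν : Measure Ω2) ≪ (μ : Measure Ω2) := by
    refine absolutelyContinuous_of_KL_ne_top (ne_top_of_le_ne_top ENNReal.ofReal_ne_top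
      (KL_le_of_tendsto (cs := fun _ => |θ| - S + 1) hlim tendsto_const_nhds
        (fun n => ?_) fun n => ?_))
    all_goals
      have h1 := theta_mul_tPat_le_abs σ θ (νs n : Measure Ω2)
      have h2 : 1 / ((n : ℝ) + 1) ≤ 1 := by
        rw [div_le_one (by positivity)]; linarith [Nat.cast_nonneg (α := ℝ) n]
      have h3 := hd n
      have h4 := hd0 n
    · linarith
    · rw [hKL]
      exact ENNReal.ofReal_le_ofReal (by linarith)
  have hνmem : ν ∈ Mcal := mem_Mcal_of_absolutelyContinuous hμ hac
  have hct : Tendsto (fun n : ℕ => θ * tPat σ (νs n : Measure Ω2) - S + 1 / ((n : ℝ) + 1))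
      (hyperfilter ℕ : Filter ℕ) (𝓝 (θ * tPat σ (ν : Measure Ω2) - S + 0)) :=
    (((tendsto_tPat σ hνmem hlim).const_mul θ).sub_const S).add hone
  have hle : KL ν (μ : Measure Ω2) ≤ ENNReal.ofReal (θ * tPat σ (ν : Measure Ω2) - S + 0) :=
    KL_le_of_tendsto hlim hct (fun n => (hd0 n).trans (hd n))
      fun n => by rw [hKL]; exact ENNReal.ofReal_le_ofReal (hd n)
  have hnn : 0 ≤ θ * tPat σ (ν : Measure Ω2) - S + 0 :=
    ge_of_tendsto' hct fun n => (hd0 n).trans (hd n)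
  refine ⟨ν, hνmem, le_antisymm ?_ ?_⟩
  · exact le_iSup₂ (f := fun (ν : ProbabilityMeasure Ω2) (_ : ν ∈ Mcal) =>
      (((θ * tPat σ (ν : Measure Ω2) : ℝ) : EReal)
        - ((KL (↑ν) (μ : Measure Ω2) : ℝ≥0∞) : EReal))) ν hνmem
  · rw [← hS]
    refine le_trans ?_ (EReal.sub_le_sub le_rfl (EReal.coe_ennreal_le_coe_ennreal_iff.2 hle))
    rw [coe_sub_coe_ofReal hnn, EReal.coe_le_coe_iff]
    linarith

lemma pi_withDensity_ofReal {k : ℕ} {μ : Measure Ω2} [IsProbabilityMeasure μ] {g : Ω2 → ℝ}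
    (hg : Measurable g) (hg0 : ∀ z, 0 ≤ g z) (hgi : Integrable g μ) :
    (Measure.pi fun _ : Fin k => μ.withDensity fun z => ENNReal.ofReal (g z)) =
      (Measure.pi fun _ : Fin k => μ).withDensity
        fun z => ENNReal.ofReal (∏ a, g (z a)) := by
  have : IsFiniteMeasure (μ.withDensity fun z => ENNReal.ofReal (g z)) :=
    isFiniteMeasure_withDensity_ofReal hgi.2
  refine Measure.pi_eq fun s hs => ?_
  rw [withDensity_apply _ (MeasurableSet.univ_pi hs), ← lintegral_indicator
    (MeasurableSet.univ_pi hs)]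
  have h1 : ∀ z : Fin k → Ω2, (Set.univ.pi s).indicator
      (fun z => ENNReal.ofReal (∏ a, g (z a))) z
      = ∏ a, (s a).indicator (fun x => ENNReal.ofReal (g x)) (z a) := by
    intro z
    by_cases hz : z ∈ Set.univ.pi s
    · rw [Set.indicator_of_mem hz, ENNReal.ofReal_prod_of_nonneg fun a _ => hg0 _]
      exact Finset.prod_congr rfl fun a _ =>
        (Set.indicator_of_mem (hz a trivial) fun x => ENNReal.ofReal (g x)).symm
    · rw [Set.indicator_of_notMem hz]
      simp only [Set.mem_pi, Set.mem_univ, true_imp_iff, not_forall] at hz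
      obtain ⟨a, ha⟩ := hz
      exact (Finset.prod_eq_zero (Finset.mem_univ a) (Set.indicator_of_notMem ha _)).symm
  have hm : ∀ a, Measurable ((s a).indicator fun x => ENNReal.ofReal (g x)) := fun a =>
    hg.ennreal_ofReal.indicator (hs a)
  simp_rw [h1]
  rw [ProbabilityTheory.lintegral_prod_eq_prod_lintegral_of_indepFun Finset.univ
    (fun a (z : Fin k → Ω2) => (s a).indicator (fun x => ENNReal.ofReal (g x)) (z a))
    (ProbabilityTheory.iIndepFun_pi (μ := fun _ : Fin k => μ) fun a => (hm a).aemeasurable)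
    fun a => (hm a).comp (measurable_pi_apply a)]
  refine Finset.prod_congr rfl fun a _ => ?_
  rw [withDensity_apply _ (hs a), ← lintegral_indicator (hs a)]
  exact (measurePreserving_eval (fun _ : Fin k => μ) a).lintegral_comp (hm a)

lemma tPat_withDensity {k : ℕ} (σ : Equiv.Perm (Fin k)) {μ : Measure Ω2} [IsProbabilityMeasure μ]
    {g : Ω2 → ℝ} (hg : Measurable g) (hg0 : ∀ z, 0 ≤ g z) (hgi : Integrable g μ) :
    tPat σ (μ.withDensity fun z => ENNReal.ofReal (g z)) =
      ∫ z, hPat σ z * ∏ a, g (z a) ∂(Measure.pi fun _ : Fin k => μ) := by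
  rw [tPat, pi_withDensity_ofReal hg hg0 hgi, integral_withDensity_eq_integral_toReal_smul
    (by fun_prop) (Eventually.of_forall fun _ => ENNReal.ofReal_lt_top)]
  refine integral_congr_ae (Eventually.of_forall fun z => ?_)
  simp only [smul_eq_mul]
  rw [ENNReal.toReal_ofReal (Finset.prod_nonneg fun a _ => hg0 _), mul_comm]

lemma integrable_hPat_mul_prod {k : ℕ} (σ : Equiv.Perm (Fin k)) {μ : Measure Ω2}
    [IsProbabilityMeasure μ] {w : Fin k → Ω2 → ℝ} (hw : ∀ a, Integrable (w a) μ) :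
    Integrable (fun z => hPat σ z * ∏ a, w a (z a)) (Measure.pi fun _ : Fin k => μ) := by
  refine (Integrable.fintype_prod_dep hw).bdd_mul (c := 1) (measurable_hPat σ).aestronglyMeasurable
    (Eventually.of_forall fun z => ?_)
  rw [Real.norm_eq_abs, abs_of_nonneg (hPat_nonneg σ z)]
  exact hPat_le_one σ z

lemma hPat_insertNth {k : ℕ} (σ : Equiv.Perm (Fin (k + 1))) (a : Fin (k + 1)) (x : Ω2)
    (w : Fin k → Ω2) : hPat σ (a.insertNth x w) = hPat σ (Fin.cons x w) := by
  rw [← hPat_comp_perm σ a.cycleRange (Fin.cons x w)]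
  congr 1
  ext1 i
  induction i using a.succAboveCases with
  | x => simp
  | p j => simp [Fin.cycleRange_succAbove]

section Linearisation

variable {k : ℕ} (σ : Equiv.Perm (Fin (k + 1))) {μ : Measure Ω2} [IsProbabilityMeasure μ]
  {g u : Ω2 → ℝ}

/-- Replacing a single factor of the product by `u` gives the integral of `u` against the
inner Euler–Lagrange integral, whichever factor is replaced. -/
lemma integral_hPat_mul_prod_ite (hg : Integrable g μ) (hu : Integrable u μ) (a : Fin (k + 1)) :
    ∫ z, hPat σ z * ∏ i, (if i = a then u else g) (z i) ∂(Measure.pi fun _ : Fin (k + 1) => μ)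
      = ∫ x, u x * ELint σ μ g x ∂μ := by
  have hint : Integrable (fun z => hPat σ z * ∏ i, (if i = a then u else g) (z i))
      (Measure.pi fun _ : Fin (k + 1) => μ) := by
    refine integrable_hPat_mul_prod σ fun i => ?_
    split_ifs <;> assumption
  have hmp := (measurePreserving_piFinSuccAbove (fun _ : Fin (k + 1) => μ) a).symm
  rw [← hmp.integrable_comp_emb (MeasurableEquiv.measurableEmbedding _)] at hint
  rw [← hmp.integral_comp']
  refine (integral_prod _ hint).trans (integral_congr_ae (Eventually.of_forall fun x => ?_))
  simp only [ELint, pmeas]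
  rw [← integral_const_mul]
  refine integral_congr_ae (Eventually.of_forall fun w => ?_)
  have he : (MeasurableEquiv.piFinSuccAbove (fun _ : Fin (k + 1) => Ω2) a).symm (x, w)
      = a.insertNth x w := rfl
  simp only [Function.comp_apply, he, hPat_insertNth, Fin.prod_univ_succAbove _ a, Fin.insertNth_apply_same,
    Fin.insertNth_apply_succAbove, if_true, Fin.succAbove_ne, if_false]
  ring

/-- The pattern density is differentiable along segments of densities. -/
lemma hasDerivAt_integral_hPat_mul_prod (hg : Integrable g μ) (hu : Integrable u μ) :
    HasDerivAt (fun s : ℝ => ∫ z, hPat σ z * ∏ i, (g (z i) + s * u (z i))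
        ∂(Measure.pi fun _ : Fin (k + 1) => μ))
      (((k : ℝ) + 1) * ∫ x, u x * ELint σ μ g x ∂μ) 0 := by
  classical
  let c : Finset (Fin (k + 1)) → ℝ := fun t =>
    ∫ z, hPat σ z * ∏ i, (if i ∈ t then u else g) (z i) ∂(Measure.pi fun _ : Fin (k + 1) => μ)
  have hci : ∀ t : Finset (Fin (k + 1)), Integrable
      (fun z => hPat σ z * ∏ i, (if i ∈ t then u else g) (z i))
      (Measure.pi fun _ : Fin (k + 1) => μ) := fun t =>
    integrable_hPat_mul_prod σ fun i => by split_ifs <;> assumption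
  have hexpand : (fun s : ℝ => ∫ z, hPat σ z * ∏ i, (g (z i) + s * u (z i))
        ∂(Measure.pi fun _ : Fin (k + 1) => μ))
      = fun s => ∑ t ∈ (Finset.univ : Finset (Fin (k + 1))).powerset, s ^ t.card * c t := by
    ext s
    simp only [c, ← integral_const_mul]
    rw [← integral_finsetSum _ fun t _ => (hci t).const_mul _]
    refine integral_congr_ae (Eventually.of_forall fun z => ?_)
    simp only
    have h1 : ∀ i, g (z i) + s * u (z i) = s * u (z i) + g (z i) := fun i => add_comm _ _
    simp only [h1, Finset.prod_add, Finset.mul_sum]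
    refine Finset.sum_congr rfl fun t _ => ?_
    have h2 : ∏ i, (if i ∈ t then u else g) (z i)
        = (∏ i ∈ t, u (z i)) * ∏ i ∈ Finset.univ \ t, g (z i) := by
      rw [← Finset.prod_sdiff (Finset.subset_univ t), mul_comm]
      congr 1
      · exact Finset.prod_congr rfl fun i hi => by rw [if_pos hi]
      · exact Finset.prod_congr rfl fun i hi => by rw [if_neg (Finset.mem_sdiff.1 hi).2]
    rw [h2, Finset.prod_mul_distrib, Finset.prod_const]
    ring
  rw [hexpand]
  have hd : HasDerivAt
      (fun s : ℝ => ∑ t ∈ (Finset.univ : Finset (Fin (k + 1))).powerset, s ^ t.card * c t)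
      (∑ t ∈ (Finset.univ : Finset (Fin (k + 1))).powerset,
        ((t.card : ℝ) * 0 ^ (t.card - 1)) * c t) 0 :=
    HasDerivAt.fun_sum fun t _ => (hasDerivAt_pow t.card (0 : ℝ)).mul_const _
  convert hd using 1
  have hterm : ∀ t : Finset (Fin (k + 1)), ((t.card : ℝ) * 0 ^ (t.card - 1)) * c t
      = if t.card = 1 then ∫ x, u x * ELint σ μ g x ∂μ else 0 := by
    intro t
    split_ifs with h
    · obtain ⟨a, rfl⟩ := Finset.card_eq_one.1 h
      simp only [c, Finset.mem_singleton, integral_hPat_mul_prod_ite σ hg hu a]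
      simp
    · rcases Nat.eq_zero_or_pos t.card with h0 | h0
      · simp [h0]
      · have : t.card - 1 ≠ 0 := by omega
        simp [this]
  simp only [hterm]
  rw [Finset.sum_powerset_apply_card
    (f := fun n => if n = 1 then ∫ x, u x * ELint σ μ g x ∂μ else 0)]
  simp

lemma measurable_ELint (hg : Measurable g) : Measurable (ELint σ μ g) := by
  have h : StronglyMeasurable fun p : Ω2 × (Fin k → Ω2) =>
      hPat σ (Fin.cons p.1 p.2) * ∏ a : Fin k, g (p.2 a) := by
    refine Measurable.stronglyMeasurable (Measurable.mul ?_ (by fun_prop))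
    refine (measurable_hPat σ).comp (measurable_pi_iff.2 fun i => ?_)
    induction i using Fin.cases with
    | zero => exact measurable_fst
    | succ j => exact (measurable_pi_apply j).comp measurable_snd
  unfold ELint pmeas
  exact h.integral_prod_right'.measurable

lemma abs_ELint_le_one (hg0 : ∀ z, 0 ≤ g z) (hgi : Integrable g μ)
    (hg1 : ∫ z, g z ∂μ = 1) (x : Ω2) : |ELint σ μ g x| ≤ 1 := by
  have hp : ∀ w : Fin k → Ω2, 0 ≤ ∏ a, g (w a) := fun w => Finset.prod_nonneg fun a _ => hg0 _
  have hn : ∀ w : Fin k → Ω2, 0 ≤ hPat σ (Fin.cons x w) * ∏ a, g (w a) := fun w =>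
    mul_nonneg (hPat_nonneg σ _) (hp w)
  unfold ELint pmeas
  rw [abs_of_nonneg (integral_nonneg hn)]
  calc ∫ w : Fin k → Ω2, hPat σ (Fin.cons x w) * ∏ a, g (w a) ∂(Measure.pi fun _ => μ)
      ≤ ∫ w : Fin k → Ω2, ∏ a, g (w a) ∂(Measure.pi fun _ => μ) :=
        integral_mono_of_nonneg (Eventually.of_forall hn) (Integrable.fintype_prod_dep fun _ => hgi)
          (Eventually.of_forall fun w => mul_le_of_le_one_left (hp w) (hPat_le_one σ _))
    _ = 1 := by rw [integral_fintype_prod_eq_prod (fun _ => g)]; simp [hg1]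

end Linearisation

lemma KL_withDensity {μ : Measure Ω2} [IsProbabilityMeasure μ] {g : Ω2 → ℝ} (hg : Measurable g)
    (hg0 : ∀ z, 0 ≤ g z) (hi : Integrable (fun z => InformationTheory.klFun (g z)) μ) :
    KL (μ.withDensity fun z => ENNReal.ofReal (g z)) μ
      = ENNReal.ofReal (∫ z, InformationTheory.klFun (g z) ∂μ) := by
  rw [KL_eq_lintegral_klFun (withDensity_absolutelyContinuous _ _),
    ofReal_integral_eq_lintegral_ofReal hi
      (Eventually.of_forall fun z => InformationTheory.klFun_nonneg (hg0 z))]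
  refine lintegral_congr_ae ?_
  filter_upwards [Measure.rnDeriv_withDensity μ hg.ennreal_ofReal] with z hz
  rw [hz, ENNReal.toReal_ofReal (hg0 z)]

lemma KL_ne_top_of_mem_Fset {k : ℕ} (σ : Equiv.Perm (Fin k)) {μ ν : ProbabilityMeasure Ω2}
    (hμ : μ ∈ Mcal) {θ : ℝ} (hν : ν ∈ Fset σ (μ : Measure Ω2) θ) :
    KL ν (μ : Measure Ω2) ≠ ∞ := by
  intro h
  have h1 := theta_mul_tPat_le_Fsup σ hμ θ
  rw [← hν.2, h] at h1
  rw [EReal.coe_ennreal_top, EReal.sub_top, le_bot_iff] at h1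
  exact EReal.coe_ne_bot _ h1

/-- A maximizer beats every competitor given by a density. -/
lemma le_of_mem_Fset {k : ℕ} (σ : Equiv.Perm (Fin k)) {μ ν : ProbabilityMeasure Ω2}
    (hμ : μ ∈ Mcal) {θ : ℝ} (hν : ν ∈ Fset σ (μ : Measure Ω2) θ) {g : Ω2 → ℝ}
    (hg : Measurable g) (hg0 : ∀ z, 0 ≤ g z) (hgi : Integrable g (μ : Measure Ω2))
    (hg1 : ∫ z, g z ∂(μ : Measure Ω2) = 1)
    (hkl : Integrable (fun z => InformationTheory.klFun (g z)) (μ : Measure Ω2)) :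
    θ * (∫ z, hPat σ z * ∏ a, g (z a) ∂(Measure.pi fun _ : Fin k => (μ : Measure Ω2)))
        - ∫ z, InformationTheory.klFun (g z) ∂(μ : Measure Ω2)
      ≤ θ * tPat σ (ν : Measure Ω2) - ∫ z, InformationTheory.klFun
        ((ν : Measure Ω2).rnDeriv (μ : Measure Ω2) z).toReal ∂(μ : Measure Ω2) := by
  let ρ : ProbabilityMeasure Ω2 :=
    ⟨(μ : Measure Ω2).withDensity fun z => ENNReal.ofReal (g z), ⟨by
      rw [withDensity_apply _ MeasurableSet.univ, Measure.restrict_univ,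
        ← ofReal_integral_eq_lintegral_ofReal hgi (Eventually.of_forall hg0), hg1,
        ENNReal.ofReal_one]⟩⟩
  have hρ : (ρ : Measure Ω2) = (μ : Measure Ω2).withDensity fun z => ENNReal.ofReal (g z) := rfl
  have hρM : ρ ∈ Mcal :=
    mem_Mcal_of_absolutelyContinuous hμ (withDensity_absolutelyContinuous _ _)
  have h := le_iSup₂ (f := fun (ν : ProbabilityMeasure Ω2) (_ : ν ∈ Mcal) =>
    (((θ * tPat σ (ν : Measure Ω2) : ℝ) : EReal)
      - ((KL (↑ν) (μ : Measure Ω2) : ℝ≥0∞) : EReal))) ρ hρM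
  change _ ≤ Fsup σ (μ : Measure Ω2) θ at h
  rw [← hν.2, hρ, KL_withDensity hg hg0 hkl, tPat_withDensity σ hg hg0 hgi,
    KL_eq_ofReal_integral (KL_ne_top_of_mem_Fset σ hμ hν), coe_sub_coe_ofReal, coe_sub_coe_ofReal,
    EReal.coe_le_coe_iff] at h
  · exact h
  · exact integral_nonneg fun z => InformationTheory.klFun_nonneg ENNReal.toReal_nonneg
  · exact integral_nonneg fun z => InformationTheory.klFun_nonneg (hg0 z)

lemma tPat_eq_integral_rnDeriv {k : ℕ} (σ : Equiv.Perm (Fin k)) {ν μ : Measure Ω2}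
    [IsProbabilityMeasure ν] [IsProbabilityMeasure μ] (h : ν ≪ μ) :
    tPat σ ν = ∫ z, hPat σ z * ∏ a, (ν.rnDeriv μ (z a)).toReal
      ∂(Measure.pi fun _ : Fin k => μ) := by
  rw [← tPat_withDensity σ (Measure.measurable_rnDeriv ν μ).ennreal_toReal
    (fun _ => ENNReal.toReal_nonneg) Measure.integrable_toReal_rnDeriv]
  congr 1
  conv_lhs => rw [← Measure.withDensity_rnDeriv_eq ν μ h]
  refine withDensity_congr_ae ?_
  filter_upwards [Measure.rnDeriv_lt_top ν μ] with z hz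
  exact (ENNReal.ofReal_toReal hz.ne).symm

/-- First-order optimality: the linearised functional at a maximizer with density `g` is at
most the increment of the entropy in the direction of any competing density `f`. -/
lemma linearised_le_of_mem_Fset {k : ℕ} (σ : Equiv.Perm (Fin (k + 1)))
    {μ ν : ProbabilityMeasure Ω2} (hμ : μ ∈ Mcal) {θ : ℝ} (hν : ν ∈ Fset σ (μ : Measure Ω2) θ)
    {g : Ω2 → ℝ} (hg : g = fun z => ((ν : Measure Ω2).rnDeriv (μ : Measure Ω2) z).toReal)
    {f : Ω2 → ℝ} (hf : Measurable f) (hf0 : ∀ z, 0 ≤ f z) (hfi : Integrable f (μ : Measure Ω2))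
    (hf1 : ∫ z, f z ∂(μ : Measure Ω2) = 1)
    (hkl : Integrable (fun z => InformationTheory.klFun (f z)) (μ : Measure Ω2)) :
    θ * (((k : ℝ) + 1) * ∫ x, (f x - g x) * ELint σ (μ : Measure Ω2) g x ∂(μ : Measure Ω2))
      ≤ ∫ z, InformationTheory.klFun (f z) ∂(μ : Measure Ω2)
        - ∫ z, InformationTheory.klFun (g z) ∂(μ : Measure Ω2) := by
  have hKν := KL_ne_top_of_mem_Fset σ hμ hν
  have hac := absolutelyContinuous_of_KL_ne_top hKν
  have hgm : Measurable g := by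
    rw [hg]; exact (Measure.measurable_rnDeriv _ _).ennreal_toReal
  have hg0 : ∀ z, 0 ≤ g z := fun z => by rw [hg]; exact ENNReal.toReal_nonneg
  have hgi : Integrable g (μ : Measure Ω2) := by rw [hg]; exact Measure.integrable_toReal_rnDeriv
  have hg1 : ∫ z, g z ∂(μ : Measure Ω2) = 1 := by
    rw [hg, Measure.integral_toReal_rnDeriv hac]; simp
  have hgkl : Integrable (fun z => InformationTheory.klFun (g z)) (μ : Measure Ω2) := by
    rw [hg]; exact integrable_klFun_of_KL_ne_top hKν
  have hu : Integrable (fun z => f z - g z) (μ : Measure Ω2) := hfi.sub hgi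
  let B : ℝ → ℝ := fun s => ∫ z, hPat σ z * ∏ i, (g (z i) + s * (f (z i) - g (z i)))
    ∂(Measure.pi fun _ : Fin (k + 1) => (μ : Measure Ω2))
  have hB0 : B 0 = tPat σ (ν : Measure Ω2) := by
    simp only [B, zero_mul, add_zero]
    rw [tPat_eq_integral_rnDeriv σ hac, hg]
  have hder := (hasDerivAt_integral_hPat_mul_prod σ hgi hu).tendsto_slope_zero_right
  simp only [zero_add] at hder
  change Tendsto (fun t => t⁻¹ • (B t - B 0)) _ _ at hder
  refine le_of_tendsto (hder.const_mul θ) ?_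
  filter_upwards [Ioo_mem_nhdsGT (zero_lt_one' ℝ)] with s hs
  have hs0 := hs.1
  have hs1 : 0 ≤ 1 - s := by linarith [hs.2]
  have hcomb : ∀ z, g z + s * (f z - g z) = (1 - s) * g z + s * f z := fun z => by ring
  have hs_nonneg : ∀ z, 0 ≤ g z + s * (f z - g z) := fun z => by
    rw [hcomb]; exact add_nonneg (mul_nonneg hs1 (hg0 z)) (mul_nonneg hs0.le (hf0 z))
  have hconv : ∀ z, InformationTheory.klFun (g z + s * (f z - g z))
      ≤ (1 - s) * InformationTheory.klFun (g z) + s * InformationTheory.klFun (f z) := fun z => by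
    rw [hcomb]
    exact InformationTheory.convexOn_klFun.2 (hg0 z) (hf0 z) hs1 hs0.le (by ring)
  have hbd := (hgkl.const_mul (1 - s)).add (hkl.const_mul s)
  have hskl : Integrable (fun z => InformationTheory.klFun (g z + s * (f z - g z)))
      (μ : Measure Ω2) := by
    refine hbd.mono' (InformationTheory.measurable_klFun.comp (by fun_prop)).aestronglyMeasurable
      (Eventually.of_forall fun z => ?_)
    rw [Real.norm_eq_abs, abs_of_nonneg (InformationTheory.klFun_nonneg (hs_nonneg z))]
    exact hconv z
  have hopt := le_of_mem_Fset σ hμ hν (g := fun z => g z + s * (f z - g z)) (by fun_prop)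
    hs_nonneg (hgi.add (hu.const_mul s)) (by
      rw [integral_add hgi (hu.const_mul s), integral_const_mul, integral_sub hfi hgi, hf1, hg1]
      ring) hskl
  have hle : ∫ z, InformationTheory.klFun (g z + s * (f z - g z)) ∂(μ : Measure Ω2)
      ≤ (1 - s) * ∫ z, InformationTheory.klFun (g z) ∂(μ : Measure Ω2)
        + s * ∫ z, InformationTheory.klFun (f z) ∂(μ : Measure Ω2) := by
    rw [← integral_const_mul, ← integral_const_mul,
      ← integral_add (hgkl.const_mul (1 - s)) (hkl.const_mul s)]
    exact integral_mono hskl hbd hconv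
  have hKg : ∫ z, InformationTheory.klFun (g z) ∂(μ : Measure Ω2) = ∫ z, InformationTheory.klFun
      ((ν : Measure Ω2).rnDeriv (μ : Measure Ω2) z).toReal ∂(μ : Measure Ω2) := by rw [hg]
  rw [← hKg, ← hB0] at hopt
  change θ * B s - _ ≤ _ at hopt
  rw [smul_eq_mul]
  have : θ * (s⁻¹ * (B s - B 0)) = (θ * (B s - B 0)) / s := by field_simp
  rw [this, div_le_iff₀ hs0]
  linarith

/-- The Gibbs density with potential `V` is the only density `g` that is optimal to first order. -/
lemma ae_eq_gibbs_of_linearised_le {μ : Measure Ω2} [IsProbabilityMeasure μ] {g V : Ω2 → ℝ}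
    (hg0 : ∀ z, 0 ≤ g z) (hgi : Integrable g μ) (hg1 : ∫ z, g z ∂μ = 1)
    (hgkl : Integrable (fun z => InformationTheory.klFun (g z)) μ)
    (hV : Measurable V) {M : ℝ} (hVM : ∀ z, |V z| ≤ M)
    (h : ∀ f : Ω2 → ℝ, Measurable f → (∀ z, 0 ≤ f z) → Integrable f μ → ∫ z, f z ∂μ = 1 →
      Integrable (fun z => InformationTheory.klFun (f z)) μ →
      ∫ z, (f z - g z) * V z ∂μ
        ≤ ∫ z, InformationTheory.klFun (f z) ∂μ - ∫ z, InformationTheory.klFun (g z) ∂μ) :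
    ∀ᵐ z ∂μ, g z = Real.exp (V z) / ∫ z', Real.exp (V z') ∂μ := by
  have hexpi : Integrable (fun z => Real.exp (V z)) μ := by
    refine Integrable.of_bound (C := Real.exp M) (Real.measurable_exp.comp hV).aestronglyMeasurable
      (Eventually.of_forall fun z => ?_)
    rw [Real.norm_eq_abs, Real.abs_exp, Real.exp_le_exp]
    exact (le_abs_self _).trans (hVM z)
  set Z := ∫ z', Real.exp (V z') ∂μ with hZ
  have hZpos : 0 < Z := integral_exp_pos hexpi
  let f : Ω2 → ℝ := fun z => Real.exp (V z) / Z
  have hfdef : ∀ z, f z = Real.exp (V z) / Z := fun z => rfl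
  have hfpos : ∀ z, 0 < f z := fun z => div_pos (Real.exp_pos _) hZpos
  have hfm : Measurable f := (Real.measurable_exp.comp hV).div_const Z
  have hfi : Integrable f μ := hexpi.div_const Z
  have hf1 : ∫ z, f z ∂μ = 1 := by
    simp only [f]; rw [integral_div, ← hZ, div_self hZpos.ne']
  have hlogf : ∀ z, Real.log (f z) = V z - Real.log Z := fun z => by
    rw [hfdef, Real.log_div (Real.exp_pos _).ne' hZpos.ne', Real.log_exp]
  have hVb : ∀ u : Ω2 → ℝ, Integrable u μ → Integrable (fun z => u z * V z) μ := fun u hu =>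
    hu.mul_bdd (c := M) hV.aestronglyMeasurable (Eventually.of_forall hVM)
  have hklf : ∀ z, InformationTheory.klFun (f z) = f z * V z - Real.log Z * f z + 1 - f z :=
    fun z => by rw [InformationTheory.klFun_apply, hlogf]; ring
  have hfkl : Integrable (fun z => InformationTheory.klFun (f z)) μ := by
    simp only [hklf]
    exact (((hVb f hfi).sub (hfi.const_mul _)).add (integrable_const _)).sub hfi
  have hmain := h f hfm (fun z => (hfpos z).le) hfi hf1 hfkl
  have hid : ∀ z, f z * InformationTheory.klFun (g z / f z)
      = (f z - g z) * V z - InformationTheory.klFun (f z) + InformationTheory.klFun (g z)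
        - Real.log Z * f z + Real.log Z * g z := by
    intro z
    have hf' := (hfpos z).ne'
    rw [hklf, InformationTheory.klFun_apply, InformationTheory.klFun_apply]
    rcases (hg0 z).eq_or_lt with h0 | h0
    · rw [← h0]; simp; ring
    · rw [Real.log_div h0.ne' hf', hlogf]
      field_simp
      ring
  have hi1 : Integrable (fun z => (f z - g z) * V z) μ := hVb _ (hfi.sub hgi)
  have hi12 : Integrable (fun z => (f z - g z) * V z - InformationTheory.klFun (f z)) μ :=
    hi1.sub hfkl
  have hi2 : Integrable (fun z => (f z - g z) * V z - InformationTheory.klFun (f z)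
      + InformationTheory.klFun (g z)) μ := hi12.add hgkl
  have hi3 : Integrable (fun z => (f z - g z) * V z - InformationTheory.klFun (f z)
      + InformationTheory.klFun (g z) - Real.log Z * f z) μ := hi2.sub (hfi.const_mul _)
  have hint : Integrable (fun z => f z * InformationTheory.klFun (g z / f z)) μ := by
    simp only [hid]
    exact hi3.add (hgi.const_mul _)
  have hzero : ∫ z, f z * InformationTheory.klFun (g z / f z) ∂μ ≤ 0 := by
    have : ∫ z, f z * InformationTheory.klFun (g z / f z) ∂μ
        = ∫ z, (f z - g z) * V z ∂μ - ∫ z, InformationTheory.klFun (f z) ∂μ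
          + ∫ z, InformationTheory.klFun (g z) ∂μ - Real.log Z * ∫ z, f z ∂μ
          + Real.log Z * ∫ z, g z ∂μ := by
      simp only [hid]
      rw [← integral_const_mul (Real.log Z) f, ← integral_const_mul (Real.log Z) g, ← integral_sub hi1 hfkl,
        ← integral_add hi12 hgkl, ← integral_sub hi2 (hfi.const_mul _),
        ← integral_add hi3 (hgi.const_mul _)]
    rw [this, hf1, hg1]
    linarith
  have hnn : ∀ z, 0 ≤ f z * InformationTheory.klFun (g z / f z) := fun z =>
    mul_nonneg (hfpos z).le (InformationTheory.klFun_nonneg (div_nonneg (hg0 z) (hfpos z).le))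
  have hae := (integral_eq_zero_iff_of_nonneg hnn hint).1
    (le_antisymm hzero (integral_nonneg hnn))
  filter_upwards [hae] with z hz
  have h1 : InformationTheory.klFun (g z / f z) = 0 :=
    (mul_eq_zero.1 hz).resolve_left (hfpos z).ne'
  rw [InformationTheory.klFun_eq_zero_iff (div_nonneg (hg0 z) (hfpos z).le),
    div_eq_one_iff_eq (hfpos z).ne'] at h1
  exact h1

lemma eulerLagrange_of_mem_Fset {k : ℕ} (σ : Equiv.Perm (Fin (k + 1)))
    {μ ν : ProbabilityMeasure Ω2} (hμ : μ ∈ Mcal) {θ : ℝ} (hν : ν ∈ Fset σ (μ : Measure Ω2) θ) :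
    ∀ᵐ z₁ ∂(μ : Measure Ω2),
      ((ν : Measure Ω2).rnDeriv (↑μ) z₁).toReal =
        Real.exp (((k : ℝ) + 1) * θ *
            ELint σ (↑μ) (fun z => ((ν : Measure Ω2).rnDeriv (↑μ) z).toReal) z₁) /
          ∫ z', Real.exp (((k : ℝ) + 1) * θ *
            ELint σ (↑μ) (fun z => ((ν : Measure Ω2).rnDeriv (↑μ) z).toReal) z')
            ∂(μ : Measure Ω2) := by
  have hKν := KL_ne_top_of_mem_Fset σ hμ hν
  have hac := absolutelyContinuous_of_KL_ne_top hKν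
  have hg1 : ∫ z, ((ν : Measure Ω2).rnDeriv (μ : Measure Ω2) z).toReal ∂(μ : Measure Ω2) = 1 := by
    rw [Measure.integral_toReal_rnDeriv hac]; simp
  have hgi : Integrable (fun z => ((ν : Measure Ω2).rnDeriv (μ : Measure Ω2) z).toReal)
      (μ : Measure Ω2) := Measure.integrable_toReal_rnDeriv
  refine ae_eq_gibbs_of_linearised_le
    (V := fun z₁ => ((k : ℝ) + 1) * θ *
      ELint σ (↑μ) (fun z => ((ν : Measure Ω2).rnDeriv (↑μ) z).toReal) z₁)
    (M := |((k : ℝ) + 1) * θ|) (fun z => ENNReal.toReal_nonneg) hgi hg1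
    (integrable_klFun_of_KL_ne_top hKν)
    ((measurable_ELint σ (Measure.measurable_rnDeriv _ _).ennreal_toReal).const_mul _)
    (fun z => ?_) fun f hf hf0 hfi hf1 hfkl => ?_
  · rw [abs_mul]
    exact mul_le_of_le_one_right (abs_nonneg _)
      (abs_ELint_le_one σ (fun z => ENNReal.toReal_nonneg) hgi hg1 z)
  · refine le_trans (le_of_eq ?_) (linearised_le_of_mem_Fset σ hμ hν rfl hf hf0 hfi hf1 hfkl)
    rw [← mul_assoc, ← integral_const_mul]
    refine integral_congr_ae (Eventually.of_forall fun z => ?_)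
    simp only
    ring


/-- Theorem 1.9 (ii): the supremum `sup_{ν∈ℳ}{θt_σ(ν) − D(ν|μ)}` is
attained; every maximizer `ν` satisfies `ν ≪ μ`, and its density `g = dν/dμ` satisfies the
Euler–Lagrange equation `μ`-a.e. (here the pattern `σ` has size `k+1 ≥ 1`). -/
theorem maximizer_exists_and_EL {k : ℕ} (σ : Equiv.Perm (Fin (k + 1)))
    (μ : ProbabilityMeasure Ω2) (hμ : μ ∈ Mcal) (θ : ℝ) :
    (Fset σ (↑μ) θ).Nonempty ∧
    ∀ ν ∈ Fset σ ((↑μ : Measure Ω2)) θ,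
      (ν : Measure Ω2) ≪ (μ : Measure Ω2) ∧
      ∀ᵐ z₁ ∂(μ : Measure Ω2),
        ((ν : Measure Ω2).rnDeriv (↑μ) z₁).toReal =
          Real.exp (((k : ℝ) + 1) * θ *
              ELint σ (↑μ) (fun z => ((ν : Measure Ω2).rnDeriv (↑μ) z).toReal) z₁) /
            ∫ z', Real.exp (((k : ℝ) + 1) * θ *
              ELint σ (↑μ) (fun z => ((ν : Measure Ω2).rnDeriv (↑μ) z).toReal) z')
              ∂(μ : Measure Ω2) := by
  refine ⟨Fset_nonempty σ hμ θ, fun ν hν => ?_⟩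
  have hKν := KL_ne_top_of_mem_Fset σ hμ hν
  refine ⟨absolutelyContinuous_of_KL_ne_top hKν, ?_⟩
  exact eulerLagrange_of_mem_Fset σ hμ hν

end
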